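/- The minimum of the objective value Σ_{t=1}^{δ} P_t v_t over all feasible solutions (f, y, v, z) of (FLOW) is attained and equals the optimal makespan of the instance of 1|s_j,B|C_max. -/

import Mathlib

open Finset

/-- The set of job arcs `A^J = {(i,j) : 0 ≤ i < j ≤ B, j - i = s k for some job k}`. -/
def flowAJ (n B : ℕ) (s : Fin n → ℕ) : Finset (ℕ × ℕ) :=
  ((Finset.range (B + 1)) ×ˢ (Finset.range (B + 1))).filter
    (fun q => q.1 < q.2 ∧ ∃ k : Fin n, q.2 - q.1 = s k)

/-- The set of loss arcs `A^L = {(i,B) : 1 ≤ i ≤ B-1}`. -/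
def flowAL (B : ℕ) : Finset (ℕ × ℕ) :=
  ((Finset.range (B + 1)) ×ˢ (Finset.range (B + 1))).filter
    (fun q => 1 ≤ q.1 ∧ q.1 < B ∧ q.2 = B)

/-- Feasibility for the formulation (FLOW).  Here `P : Fin δ → ℕ` lists the distinct
processing times `P_1 < … < P_δ` (the index `t : Fin δ` stands for the paper's `t+1`);
`f a t` is the flow of the job arc `a ∈ A^J` in structure `t`, `y a t` the flow on the
loss arc `a ∈ A^L`, `v t` the flow on the feedback arc, and `z c u`, for `u ∈ {0,…,δ}`
(the paper's `z_{c,u}` with conventions `z_{c,0} = z_{c,δ} = 0`), the number of jobs of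
size `c` left over for structures with larger processing time.  The conditions are:
flows vanish off the arc sets, flow conservation at node `0` (total outflow `v t`), at
node `B` (total inflow `v t`) and at the interior nodes, and the job-balance equations
`NT_{c,t} − ∑_{(i,j) ∈ A^J, j−i=c} f_{i,j,t} = z_{c,t} − z_{c,t−1}`. -/
def FlowFeasible (n B : ℕ) (s p : Fin n → ℕ) (δ : ℕ) (P : Fin δ → ℕ)
    (f y : ℕ × ℕ → Fin δ → ℕ) (v : Fin δ → ℕ) (z : ℕ → ℕ → ℕ) : Prop :=
  (∀ a t, a ∉ flowAJ n B s → f a t = 0) ∧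
  (∀ a t, a ∉ flowAL B → y a t = 0) ∧
  (∀ c, z c 0 = 0) ∧ (∀ c, z c δ = 0) ∧
  (∀ t : Fin δ,
    (∑ a ∈ (flowAJ n B s).filter (fun a => a.1 = 0), f a t)
      + (∑ a ∈ (flowAL B).filter (fun a => a.1 = 0), y a t) = v t) ∧
  (∀ t : Fin δ,
    (∑ a ∈ (flowAJ n B s).filter (fun a => a.2 = B), f a t)
      + (∑ a ∈ (flowAL B).filter (fun a => a.2 = B), y a t) = v t) ∧
  (∀ (t : Fin δ) (u : ℕ), 0 < u → u < B →
    (∑ a ∈ (flowAJ n B s).filter (fun a => a.2 = u), f a t)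
      + (∑ a ∈ (flowAL B).filter (fun a => a.2 = u), y a t)
    = (∑ a ∈ (flowAJ n B s).filter (fun a => a.1 = u), f a t)
      + (∑ a ∈ (flowAL B).filter (fun a => a.1 = u), y a t)) ∧
  (∀ (t : Fin δ) (c : ℕ), 1 ≤ c → c ≤ B →
    ((univ.filter (fun j => s j = c ∧ p j = P t)).card : ℤ)
      - ∑ a ∈ (flowAJ n B s).filter (fun a => a.2 - a.1 = c), (f a t : ℤ)
    = (z c (t.val + 1) : ℤ) - (z c t.val : ℤ))

theorem col_lemma {E : Type*} [DecidableEq E] (st en : E → ℕ) (v : ℕ) (T : Finset E) :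
    (∀ e ∈ T, st e < en e) →
    (∀ u, (T.filter (fun e => st e = u)).card ≤ (T.filter (fun e => en e = u)).card
      + if u = 0 then v else 0) →
    ∃ (col : E → ℕ) (pos : ℕ → ℕ), (∀ e ∈ T, col e < v) ∧
      (∀ k, ∑ e ∈ T.filter (fun e => col e = k), (en e - st e) = pos k) ∧
      (∀ u, ((range v).filter (fun k => pos k = u)).card + (T.filter (fun e => st e = u)).card
        = (T.filter (fun e => en e = u)).card + if u = 0 then v else 0) := by
  induction T using Finset.induction_on_max_value st with
  | empty =>
    intro _ _
    refine ⟨fun _ => 0, fun _ => 0, by simp, by simp, ?_⟩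
    intro u
    by_cases hu : u = 0
    · subst hu; simp
    · simp [hu, Ne.symm hu]
  | insert a T ha hmax ih =>
    intro h1 h2
    have hlt := h1 a (mem_insert_self _ _)
    obtain ⟨col, pos, hc, hpos, hcount⟩ := ih (fun e he => h1 e (mem_insert_of_mem he)) (by
      intro u
      have := h2 u
      rw [filter_insert, filter_insert] at this
      by_cases hu : en a = u
      · have h0 : T.filter (fun e => st e = u) = ∅ := by
          apply filter_eq_empty_iff.2
          intro e he h
          have := hmax e he
          omega
        rw [h0]; simp
      · rw [if_neg hu] at this
        refine le_trans ?_ this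
        apply card_le_card
        split_ifs
        · exact subset_insert _ _
        · exact Subset.rfl)
    have hex : ∃ k ∈ range v, pos k = st a := by
      have e1 := hcount (st a)
      have e2 := h2 (st a)
      rw [filter_insert, filter_insert, if_pos rfl, if_neg (by omega),
        card_insert_of_notMem (by simp [ha])] at e2
      have : 0 < ((range v).filter (fun k => pos k = st a)).card := by omega
      obtain ⟨k, hk⟩ := card_pos.1 this
      exact ⟨k, (mem_filter.1 hk).1, (mem_filter.1 hk).2⟩
    obtain ⟨k, hk, hka⟩ := hex
    have hcolT : ∀ e ∈ T, Function.update col a k e = col e := by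
      intro e he
      exact Function.update_of_ne (by rintro rfl; exact ha he) _ _
    refine ⟨Function.update col a k, Function.update pos k (en a), ?_, ?_, ?_⟩
    · intro e he
      rcases mem_insert.1 he with rfl | he
      · simpa using hk
      · rw [hcolT e he]; exact hc e he
    · intro k'
      have hf : T.filter (fun e => Function.update col a k e = k') =
          T.filter (fun e => col e = k') := by
        apply filter_congr
        intro e he
        rw [hcolT e he]
      rw [filter_insert, hf]
      by_cases hkk : k' = k
      · subst hkk
        simp only [Function.update_self, if_true]
        rw [sum_insert (by simp [ha]), hpos, hka]
        omega
      · simp only [Function.update_self]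
        rw [if_neg (Ne.symm hkk), Function.update_of_ne hkk, hpos]
    · intro u
      have e1 := hcount u
      have hs : ∀ (g : E → ℕ), ((insert a T).filter (fun e => g e = u)).card
          = (T.filter (fun e => g e = u)).card + if g a = u then 1 else 0 := by
        intro g
        rw [filter_insert]
        split_ifs
        · rw [card_insert_of_notMem (by simp [ha])]
        · simp
      have hp : ((range v).filter (fun k' => Function.update pos k (en a) k' = u)).card
          + (if st a = u then 1 else 0) = ((range v).filter (fun k' => pos k' = u)).card
          + (if en a = u then 1 else 0) := by
        simp only [card_filter]
        rw [← add_sum_erase _ _ hk, ← add_sum_erase (range v) (fun k' => if pos k' = u then 1 else 0) hk]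
        have : ∑ x ∈ (range v).erase k, (if Function.update pos k (en a) x = u then 1 else 0)
          = ∑ x ∈ (range v).erase k, (if pos x = u then 1 else 0) := by
          apply sum_congr rfl
          intro x hx
          rw [Function.update_of_ne (ne_of_mem_erase hx)]
        rw [this, Function.update_self, hka]
        omega
      rw [hs, hs]
      omega

theorem match_lemma {X Y : Type*} [Fintype X] [DecidableEq Y] (a : X → ℕ) (b : Y → ℕ)
    (T : Finset Y)
    (h : ∀ u, (univ.filter (fun x => u ≤ a x)).card ≤ (T.filter (fun y => u ≤ b y)).card) :
    ∃ f : X → Y, Function.Injective f ∧ ∀ x, f x ∈ T ∧ a x ≤ b (f x) := by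
  obtain ⟨f, hf, hm⟩ := (Finset.all_card_le_biUnion_card_iff_exists_injective
    (fun x => T.filter (fun y => a x ≤ b y))).1 (by
      intro A
      rcases A.eq_empty_or_nonempty with rfl | hA
      · simp
      · obtain ⟨m, hm, hmin⟩ := exists_min_image A a hA
        refine le_trans (card_le_card ?_) ((h (a m)).trans (card_le_card ?_))
        · intro x hx
          simpa using hmin x hx
        · intro y hy
          exact mem_biUnion.2 ⟨m, hm, hy⟩)
  exact ⟨f, hf, fun x => by simpa using hm x⟩

theorem tele_lemma (g : ℕ → ℤ) (u δ : ℕ) (h : u ≤ δ) :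
    ∑ t : Fin δ, (if u ≤ t.val then g (t.val + 1) - g t.val else 0) = g δ - g u := by
  rw [Fin.sum_univ_eq_sum_range (fun t => if u ≤ t then g (t + 1) - g t else 0)]
  induction δ, h using Nat.le_induction with
  | base =>
    rw [sum_eq_zero]; · ring
    intro x hx
    rw [if_neg (by simpa using hx)]
  | succ m hm ih =>
    rw [sum_range_succ, ih, if_pos hm]; ring

theorem sched_lemma {n B : ℕ} {β : Type*} [DecidableEq β] (s p : Fin n → ℕ) (g : Fin n → β)
    (w : β → ℕ) (hcap : ∀ b, ∑ j ∈ univ.filter (fun j => g j = b), s j ≤ B)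
    (hw : ∀ j, p j ≤ w (g j)) :
    ∃ Q : Finpartition (univ : Finset (Fin n)),
      (∀ S ∈ Q.parts, ∑ j ∈ S, s j ≤ B) ∧ ∑ S ∈ Q.parts, S.sup p ≤ ∑ b ∈ univ.image g, w b := by
  classical
  let F : β → Finset (Fin n) := fun b => univ.filter (fun j => g j = b)
  have hF : ∀ b j, j ∈ F b ↔ g j = b := by simp [F]
  have hinj : Set.InjOn F (univ.image g : Finset β) := by
    intro b hb b' hb' h
    simp only [coe_image, coe_univ, Set.image_univ, Set.mem_range] at hb
    obtain ⟨j, rfl⟩ := hb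
    have : j ∈ F b' := h ▸ (hF _ _).2 rfl
    exact (hF _ _).1 this
  refine ⟨⟨(univ.image g).image F, ?_, ?_, ?_⟩, ?_, ?_⟩
  · rw [Finset.supIndep_iff_pairwiseDisjoint]
    intro A hA C hC hAC
    simp only [coe_image, Set.mem_image] at hA hC
    obtain ⟨b, -, rfl⟩ := hA
    obtain ⟨b', -, rfl⟩ := hC
    simp only [Function.onFun, id]
    rw [Finset.disjoint_left]
    intro j hj hj'
    rw [hF] at hj hj'
    exact hAC (by rw [← hj, ← hj'])
  · apply Finset.eq_univ_of_forall
    intro j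
    rw [Finset.mem_sup]
    exact ⟨F (g j), mem_image_of_mem _ (mem_image_of_mem _ (mem_univ _)), (hF _ _).2 rfl⟩
  · simp only [Finset.bot_eq_empty, mem_image, not_exists, not_and]
    rintro b ⟨j, -, rfl⟩ h
    have : j ∈ F (g j) := (hF _ _).2 rfl
    simp [h] at this
  · intro S hS
    obtain ⟨b, -, rfl⟩ := mem_image.1 hS
    exact hcap b
  · show ∑ S ∈ (univ.image g).image F, S.sup p ≤ _
    rw [sum_image hinj]
    apply sum_le_sum
    intro b hb
    apply Finset.sup_le
    intro j hj
    rw [← (hF _ _).1 hj]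
    exact hw j

theorem path_lemma {n : ℕ} (s : Fin n → ℕ) (u : ℕ) (S : Finset (Fin n)) :
    (S.filter (fun j => ∑ k ∈ S.filter (fun k => k < j), s k + s j = u)).card
      + (if u = 0 then 1 else 0)
    = (S.filter (fun j => ∑ k ∈ S.filter (fun k => k < j), s k = u)).card
      + (if ∑ k ∈ S, s k = u then 1 else 0) := by
  induction S using Finset.induction_on_max with
  | empty => simp [eq_comm]
  | insert a T hmax ih =>
    have ha : a ∉ T := fun h => lt_irrefl _ (hmax a h)
    have e1 : ∀ j ∈ T, (insert a T).filter (fun k => k < j) = T.filter (fun k => k < j) := by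
      intro j hj
      rw [filter_insert, if_neg (hmax j hj).asymm]
    have e2 : (insert a T).filter (fun k => k < a) = T := by
      rw [filter_insert, if_neg (lt_irrefl _)]
      exact filter_true_of_mem hmax
    simp only [card_filter] at ih ⊢
    rw [sum_insert ha, sum_insert ha, e2, sum_insert ha]
    have e3 : ∀ w : Fin n → ℕ, ∑ j ∈ T,
        (if ∑ k ∈ (insert a T).filter (fun k => k < j), s k + w j = u then 1 else 0)
        = ∑ j ∈ T, (if ∑ k ∈ T.filter (fun k => k < j), s k + w j = u then 1 else 0) :=
      fun w => sum_congr rfl (fun j hj => by rw [e1 j hj])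
    have e4 := e3 (fun _ => 0)
    simp only [add_zero] at e4
    rw [e3 s, e4, add_comm (s a)]
    omega

theorem flow_to_sched (n B : ℕ)
    (s p : Fin n → ℕ) (hs : ∀ j, 1 ≤ s j ∧ s j ≤ B)
    (δ : ℕ) (P : Fin δ → ℕ) (hPmono : StrictMono P)
    (hPall : ∀ j, ∃ t, p j = P t)
    (f y : ℕ × ℕ → Fin δ → ℕ) (v : Fin δ → ℕ) (z : ℕ → ℕ → ℕ)
    (h : FlowFeasible n B s p δ P f y v z) :
    ∃ Q : Finpartition (univ : Finset (Fin n)),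
      (∀ S ∈ Q.parts, ∑ j ∈ S, s j ≤ B) ∧ ∑ S ∈ Q.parts, S.sup p ≤ ∑ t, P t * v t := by
  classical
  obtain ⟨-, -, -, hzδ, hout, -, hcons, hbal⟩ := h
  choose idx hidx using hPall
  have hAJ : ∀ a ∈ flowAJ n B s, a.1 < a.2 ∧ a.2 ≤ B := by
    intro a ha
    simp only [flowAJ, mem_filter, mem_product, mem_range] at ha
    omega
  -- units
  let U : Fin δ → Finset (Σ _ : ℕ × ℕ, ℕ) := fun t => (flowAJ n B s).sigma (fun a => range (f a t))
  have hU : ∀ t x, x ∈ U t → x.1 ∈ flowAJ n B s := by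
    intro t x hx
    exact (mem_sigma.1 hx).1
  have hcard : ∀ (t : Fin δ) (q : ℕ × ℕ → Prop) [DecidablePred q],
      ((U t).filter (fun x => q x.1)).card = ∑ a ∈ (flowAJ n B s).filter q, f a t := by
    intro t q _
    rw [card_filter, sum_sigma, sum_filter]
    apply sum_congr rfl
    intro a _
    simp only [sum_const, card_range]
    split_ifs <;> simp
  have hcol : ∀ t, ∃ col : (Σ _ : ℕ × ℕ, ℕ) → ℕ, (∀ e ∈ U t, col e < v t) ∧
      ∀ k, k < v t → ∑ e ∈ (U t).filter (fun e => col e = k), (e.1.2 - e.1.1) ≤ B := by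
    intro t
    obtain ⟨col, pos, h1, h2, h3⟩ := col_lemma (fun e : (Σ _ : ℕ × ℕ, ℕ) => e.1.1)
      (fun e => e.1.2) (v t) (U t) (fun e he => (hAJ _ (hU t e he)).1) (by
        intro u
        rw [hcard t (fun a => a.1 = u), hcard t (fun a => a.2 = u)]
        rcases Nat.eq_zero_or_pos u with rfl | hu
        · have := hout t
          simp only [if_true]; omega
        · by_cases huB : u < B
          · have := hcons t u hu huB
            have h0 : (flowAL B).filter (fun a => a.2 = u) = ∅ := by
              apply filter_eq_empty_iff.2
              intro a ha h
              simp only [flowAL, mem_filter] at ha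
              omega
            rw [h0, sum_empty] at this
            omega
          · have h0 : (flowAJ n B s).filter (fun a => a.1 = u) = ∅ := by
              apply filter_eq_empty_iff.2
              intro a ha h
              have := hAJ a ha
              omega
            rw [h0]; simp)
    refine ⟨col, h1, ?_⟩
    intro k hk
    rw [h2 k]
    by_contra hB
    have h4 := h3 (pos k)
    have h5 : 0 < ((range (v t)).filter (fun k' => pos k' = pos k)).card :=
      card_pos.2 ⟨k, by simp [hk]⟩
    have h6 : (U t).filter (fun e => e.1.2 = pos k) = ∅ := by
      apply filter_eq_empty_iff.2
      intro e he h
      have := hAJ _ (hU t e he)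
      omega
    rw [h6, if_neg (by omega)] at h4
    simp only [card_empty] at h4
    omega
  choose col hcol1 hcol2 using hcol
  -- matching
  let Y : Finset (Σ _ : Fin δ, (Σ _ : ℕ × ℕ, ℕ)) := univ.sigma U
  have hmatch : ∀ c, ∃ φ : {j // s j = c} → (Σ _ : Fin δ, (Σ _ : ℕ × ℕ, ℕ)),
      Function.Injective φ ∧ ∀ x, φ x ∈ Y.filter (fun e => e.2.1.2 - e.2.1.1 = c) ∧
        (idx x.1).val ≤ (φ x).1.val := by
    intro c
    apply match_lemma (fun x : {j // s j = c} => (idx x.1).val)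
      (fun e : (Σ _ : Fin δ, (Σ _ : ℕ × ℕ, ℕ)) => e.1.val)
    intro u
    by_cases hc : 1 ≤ c ∧ c ≤ B
    swap
    · have : IsEmpty {j // s j = c} := ⟨fun x => hc (x.2 ▸ hs x.1)⟩
      simp
    by_cases hu : u ≤ δ
    swap
    · rw [filter_eq_empty_iff.2]
      · simp
      · intro x _ h
        have := (idx x.1).2
        omega
    have hL : ((univ.filter (fun x : {j // s j = c} => u ≤ (idx x.1).val)).card : ℤ)
        = ∑ t : Fin δ, if u ≤ t.val then
          ((univ.filter (fun j => s j = c ∧ p j = P t)).card : ℤ) else 0 := by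
      have e1 : (univ.filter (fun x : {j // s j = c} => u ≤ (idx x.1).val)).card
          = (univ.filter (fun j => s j = c ∧ u ≤ (idx j).val)).card := by
        rw [← card_map (Function.Embedding.subtype _)]
        congr 1
        ext j
        simp [and_comm]
      rw [e1, card_eq_sum_card_fiberwise (f := idx) (t := univ) (by simp [Set.MapsTo])]
      push_cast
      apply sum_congr rfl
      intro t _
      rw [filter_filter]
      split_ifs with ht
      · congr 2
        ext j
        simp only [mem_filter, mem_univ, true_and, hidx j, hPmono.injective.eq_iff]
        constructor
        · rintro ⟨⟨a, b⟩, c⟩; exact ⟨a, c⟩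
        · rintro ⟨a, c⟩; exact ⟨⟨a, c ▸ ht⟩, c⟩
      · rw [filter_eq_empty_iff.2]
        · simp
        · rintro j _ ⟨⟨_, b⟩, rfl⟩
          exact ht b
    have hR : (((Y.filter (fun e => e.2.1.2 - e.2.1.1 = c)).filter
        (fun e => u ≤ e.1.val)).card : ℤ) = ∑ t : Fin δ, if u ≤ t.val then
          ∑ a ∈ (flowAJ n B s).filter (fun a => a.2 - a.1 = c), (f a t : ℤ) else 0 := by
      rw [filter_filter, card_filter, sum_sigma]
      push_cast
      apply sum_congr rfl
      intro t _
      split_ifs with ht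
      · rw [← Nat.cast_sum, ← hcard t (fun a => a.2 - a.1 = c), card_filter]
        push_cast
        apply sum_congr rfl
        intro e _
        simp [ht]
      · simp [ht]
    have key := tele_lemma (fun k => (z c k : ℤ)) u δ hu
    have hd : (∑ t : Fin δ, (if u ≤ t.val then
          ((univ.filter (fun j => s j = c ∧ p j = P t)).card : ℤ) else 0)) -
        ∑ t : Fin δ, (if u ≤ t.val then
          ∑ a ∈ (flowAJ n B s).filter (fun a => a.2 - a.1 = c), (f a t : ℤ) else 0)
        = (z c δ : ℤ) - z c u := by
      rw [← key, ← sum_sub_distrib]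
      apply sum_congr rfl
      intro t _
      split_ifs
      · exact hbal t c hc.1 hc.2
      · simp
    rw [← hL, ← hR, hzδ] at hd
    push_cast at hd
    omega
  choose φ hφinj hφ using hmatch
  let ψ : Fin n → (Σ _ : Fin δ, (Σ _ : ℕ × ℕ, ℕ)) := fun j => φ (s j) ⟨j, rfl⟩
  have hψlen : ∀ j, (ψ j).2.1.2 - (ψ j).2.1.1 = s j := fun j => (mem_filter.1 (hφ _ ⟨j, rfl⟩).1).2
  have hψU : ∀ j, (ψ j).2 ∈ U (ψ j).1 := fun j =>
    (mem_sigma.1 (mem_filter.1 (hφ _ ⟨j, rfl⟩).1).1).2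
  have hψle : ∀ j, idx j ≤ (ψ j).1 := fun j => (hφ _ ⟨j, rfl⟩).2
  have hψinj : Function.Injective ψ := by
    intro i j hij
    have hsz : s i = s j := by rw [← hψlen i, ← hψlen j, hij]
    have : ∀ c (h : s i = c), ψ i = φ c ⟨i, h⟩ := by rintro c rfl; rfl
    rw [this _ hsz] at hij
    have := hφinj _ hij
    exact congrArg Subtype.val this
  let g : Fin n → (Σ _ : Fin δ, ℕ) := fun j => ⟨(ψ j).1, col (ψ j).1 (ψ j).2⟩
  have hgb : ∀ j, g j ∈ (univ : Finset (Fin δ)).sigma (fun t => range (v t)) := by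
    intro j
    simp only [mem_sigma, mem_univ, true_and, mem_range, g]
    exact hcol1 _ _ (hψU j)
  obtain ⟨Q, hQ1, hQ2⟩ := sched_lemma (B := B) s p g (fun b => P b.1) (by
    intro b
    by_cases hb : b.2 < v b.1
    swap
    · rw [filter_eq_empty_iff.2]
      · simp
      · rintro j _ rfl
        have := hgb j
        simp only [mem_sigma, mem_univ, true_and, mem_range] at this
        exact hb this
    refine le_trans ?_ (hcol2 b.1 b.2 hb)
    have hinj : Set.InjOn (fun j => (ψ j).2) (univ.filter (fun j => g j = b) : Finset (Fin n)) := by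
      intro i hi j hj hij
      simp only [coe_filter, mem_univ, true_and, Set.mem_setOf_eq] at hi hj
      apply hψinj
      have h1 : (ψ i).1 = (ψ j).1 := by
        have := congrArg Sigma.fst (hi.trans hj.symm)
        exact this
      exact Sigma.ext h1 (heq_of_eq hij)
    calc ∑ j ∈ univ.filter (fun j => g j = b), s j
        = ∑ j ∈ univ.filter (fun j => g j = b), ((ψ j).2.1.2 - (ψ j).2.1.1) :=
          sum_congr rfl (fun j _ => (hψlen j).symm)
      _ = ∑ e ∈ (univ.filter (fun j => g j = b)).image (fun j => (ψ j).2), (e.1.2 - e.1.1) := by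
          rw [sum_image hinj]
      _ ≤ _ := by
          apply sum_le_sum_of_subset
          intro e he
          obtain ⟨j, hj, rfl⟩ := mem_image.1 he
          have hj := (mem_filter.1 hj).2
          subst hj
          exact mem_filter.2 ⟨hψU j, rfl⟩) (by
    intro j
    rw [hidx j]
    exact hPmono.monotone (hψle j))
  refine ⟨Q, hQ1, hQ2.trans ?_⟩
  calc ∑ b ∈ univ.image g, P b.1
      ≤ ∑ b ∈ (univ : Finset (Fin δ)).sigma (fun t => range (v t)), P b.1 := by
        apply sum_le_sum_of_subset
        intro b hb
        obtain ⟨j, -, rfl⟩ := mem_image.1 hb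
        exact hgb j
    _ = ∑ t, P t * v t := by
        rw [sum_sigma]
        apply sum_congr rfl
        intro t _
        simp [mul_comm]

theorem sched_to_flow (n B : ℕ) (hn : 1 ≤ n)
    (s p : Fin n → ℕ) (hs : ∀ j, 1 ≤ s j ∧ s j ≤ B)
    (δ : ℕ) (P : Fin δ → ℕ) (hPmono : StrictMono P)
    (hPall : ∀ j, ∃ t, p j = P t)
    (Q : Finpartition (univ : Finset (Fin n)))
    (hQ : ∀ S ∈ Q.parts, ∑ j ∈ S, s j ≤ B) :
    ∃ (f y : ℕ × ℕ → Fin δ → ℕ) (v : Fin δ → ℕ) (z : ℕ → ℕ → ℕ),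
      FlowFeasible n B s p δ P f y v z ∧ ∑ t, P t * v t = ∑ S ∈ Q.parts, S.sup p := by
  classical
  have htS : ∀ S : Finset (Fin n), ∃ t, S.Nonempty → S.sup p = P t := by
    intro S
    rcases S.eq_empty_or_nonempty with rfl | hS
    · obtain ⟨t, _⟩ := hPall ⟨0, hn⟩
      exact ⟨t, fun h => absurd h (by simp)⟩
    · obtain ⟨j, hj, hj'⟩ := exists_mem_eq_sup S hS p
      obtain ⟨t, ht⟩ := hPall j
      exact ⟨t, fun _ => by rw [hj', ht]⟩
  choose tS htS using htS
  choose idx hidx using hPall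
  have hmem : ∀ j, j ∈ Q.part j := fun j => Q.mem_part (mem_univ j)
  have hpart : ∀ j, Q.part j ∈ Q.parts := fun j => Q.part_mem.2 (mem_univ j)
  let tb : Fin n → Fin δ := fun j => tS (Q.part j)
  have hidxtb : ∀ j, (idx j).val ≤ (tb j).val := by
    intro j
    have h1 : p j ≤ (Q.part j).sup p := le_sup (f := p) (hmem j)
    rw [htS _ ⟨j, hmem j⟩, hidx j] at h1
    exact hPmono.le_iff_le.1 h1
  let st : Fin n → ℕ := fun j => ∑ k ∈ (Q.part j).filter (fun k => k < j), s k
  let arc : Fin n → ℕ × ℕ := fun j => (st j, st j + s j)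
  have hle : ∀ j, st j + s j ≤ B := by
    intro j
    refine le_trans ?_ (hQ _ (hpart j))
    have : ∑ k ∈ insert j ((Q.part j).filter (fun k => k < j)), s k = st j + s j := by
      rw [sum_insert (by simp), add_comm]
    rw [← this]
    apply sum_le_sum_of_subset
    intro k hk
    rcases mem_insert.1 hk with rfl | hk
    · exact hmem k
    · exact (mem_filter.1 hk).1
  have harc : ∀ j, arc j ∈ flowAJ n B s := by
    intro j
    have := hle j
    have := hs j
    simp only [flowAJ, mem_filter, mem_product, mem_range, arc]
    exact ⟨⟨by omega, by omega⟩, by omega, j, by omega⟩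
  have htot : ∀ S ∈ Q.parts, 1 ≤ ∑ j ∈ S, s j := by
    intro S hS
    obtain ⟨j, hj⟩ := Q.nonempty_of_mem_parts hS
    exact (hs j).1.trans (single_le_sum (f := s) (fun _ _ => Nat.zero_le _) hj)
  let f : ℕ × ℕ → Fin δ → ℕ := fun a t => (univ.filter (fun j => tb j = t ∧ arc j = a)).card
  let L : Finset (Finset (Fin n)) := Q.parts.filter (fun S => ∑ j ∈ S, s j < B)
  let y : ℕ × ℕ → Fin δ → ℕ := fun a t =>
    (L.filter (fun S => tS S = t ∧ (∑ j ∈ S, s j, B) = a)).card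
  have hL : ∀ S ∈ L, (∑ j ∈ S, s j, B) ∈ flowAL B := by
    intro S hS
    obtain ⟨h1, h2⟩ := mem_filter.1 hS
    have := htot S h1
    simp only [flowAL, mem_filter, mem_product, mem_range]
    exact ⟨⟨by omega, by omega⟩, by omega, by omega, trivial⟩
  have hf : ∀ (t : Fin δ) (q : ℕ × ℕ → Prop) [DecidablePred q],
      ∑ a ∈ (flowAJ n B s).filter q, f a t
        = ∑ S ∈ Q.parts.filter (fun S => tS S = t), (S.filter (fun j => q (arc j))).card := by
    intro t q _
    have e1 : ∑ a ∈ (flowAJ n B s).filter q, f a t =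
        (univ.filter (fun j => tb j = t ∧ q (arc j))).card := by
      rw [card_eq_sum_card_fiberwise (f := arc) (t := (flowAJ n B s).filter q)]
      · apply sum_congr rfl
        intro a ha
        have := (mem_filter.1 ha).2
        rw [filter_filter]
        simp only [f]
        congr 1
        apply filter_congr
        intro j _
        constructor
        · rintro ⟨h1, rfl⟩; exact ⟨⟨h1, this⟩, rfl⟩
        · rintro ⟨⟨h1, _⟩, h2⟩; exact ⟨h1, h2⟩
      · intro j hj
        have := (mem_filter.1 (mem_coe.1 hj)).2
        exact mem_coe.2 (mem_filter.2 ⟨harc j, this.2⟩)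
    rw [e1, card_eq_sum_card_fiberwise (f := Q.part) (t := Q.parts.filter (fun S => tS S = t))]
    · apply sum_congr rfl
      intro S hS
      obtain ⟨h1, h2⟩ := mem_filter.1 hS
      congr 1
      ext j
      simp only [mem_filter, mem_univ, true_and]
      constructor
      · rintro ⟨⟨_, h⟩, rfl⟩; exact ⟨hmem j, h⟩
      · rintro ⟨h3, h4⟩
        have h5 : Q.part j = S := Q.part_eq_of_mem h1 h3
        exact ⟨⟨by simp only [tb, h5, h2], h4⟩, h5⟩
    · intro j hj
      have := (mem_filter.1 (mem_coe.1 hj)).2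
      exact mem_coe.2 (mem_filter.2 ⟨hpart j, this.1⟩)
  have hy : ∀ (t : Fin δ) (q : ℕ × ℕ → Prop) [DecidablePred q],
      ∑ a ∈ (flowAL B).filter q, y a t
        = ∑ S ∈ Q.parts.filter (fun S => tS S = t),
          if ∑ j ∈ S, s j < B ∧ q (∑ j ∈ S, s j, B) then 1 else 0 := by
    intro t q _
    rw [← card_filter, filter_filter]
    rw [card_eq_sum_card_fiberwise (f := fun S => (∑ j ∈ S, s j, B)) (t := (flowAL B).filter q)]
    · apply sum_congr rfl
      intro a ha
      have := (mem_filter.1 ha).2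
      simp only [y, L]
      rw [filter_filter, filter_filter]
      congr 1
      apply filter_congr
      intro S _
      constructor
      · rintro ⟨h1, h2, rfl⟩; exact ⟨⟨h2, h1, this⟩, rfl⟩
      · rintro ⟨⟨h1, h2, _⟩, h3⟩; exact ⟨h2, h1, h3⟩
    · intro S hS
      obtain ⟨h1, h2, h3, h4⟩ := mem_filter.1 (mem_coe.1 hS)
      exact mem_coe.2 (mem_filter.2 ⟨hL S (mem_filter.2 ⟨h1, h3⟩), h4⟩)
  have hpath : ∀ S ∈ Q.parts, ∀ u, (S.filter (fun j => (arc j).2 = u)).card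
      + (if u = 0 then 1 else 0) = (S.filter (fun j => (arc j).1 = u)).card
      + (if ∑ k ∈ S, s k = u then 1 else 0) := by
    intro S hS u
    have := path_lemma s u S
    have e : ∀ j ∈ S, st j = ∑ k ∈ S.filter (fun k => k < j), s k := by
      intro j hj
      simp only [st, Q.part_eq_of_mem hS hj]
    rw [filter_congr (q := fun j => st j + s j = u) (fun j hj => by rw [← e j hj]),
      filter_congr (p := fun j => ∑ k ∈ S.filter (fun k => k < j), s k = u)
        (q := fun j => st j = u) (fun j hj => by rw [← e j hj])] at this
    exact this
  have hend0 : ∀ S : Finset (Fin n), (S.filter (fun j => (arc j).2 = 0)).card = 0 := by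
    intro S
    rw [card_eq_zero, filter_eq_empty_iff]
    intro j _ h
    have := hs j
    simp only [arc] at h
    omega
  have hstB : ∀ S : Finset (Fin n), (S.filter (fun j => (arc j).1 = B)).card = 0 := by
    intro S
    rw [card_eq_zero, filter_eq_empty_iff]
    intro j _ h
    have := hs j
    have := hle j
    simp only [arc] at h
    omega
  have hB : 1 ≤ B := (hs ⟨0, hn⟩).1.trans (hs ⟨0, hn⟩).2
  refine ⟨f, y, fun t => (Q.parts.filter (fun S => tS S = t)).card,
    fun c u => (univ.filter (fun j => s j = c ∧ (idx j).val < u ∧ u ≤ (tb j).val)).card,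
    ⟨?_, ?_, ?_, ?_, ?_, ?_, ?_, ?_⟩, ?_⟩
  · intro a t ha
    simp only [f]
    rw [card_eq_zero, filter_eq_empty_iff]
    rintro j _ ⟨_, rfl⟩
    exact ha (harc j)
  · intro a t ha
    simp only [y]
    rw [card_eq_zero, filter_eq_empty_iff]
    rintro S hS ⟨_, rfl⟩
    exact ha (hL S hS)
  · intro c; simp
  · intro c
    rw [card_eq_zero, filter_eq_empty_iff]
    rintro j _ ⟨_, _, h⟩
    have := (tb j).2
    omega
  · intro t
    rw [hf t (fun a => a.1 = 0), hy t (fun a => a.1 = 0), ← sum_add_distrib]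
    beta_reduce
    rw [card_eq_sum_ones]
    apply sum_congr rfl
    intro S hS
    have hS := (mem_filter.1 hS).1
    have h1 := hpath S hS 0
    have h2 := hend0 S
    have h3 := htot S hS
    rw [if_neg (by omega)]
    rw [if_pos rfl, if_neg (by omega)] at h1
    omega
  · intro t
    rw [hf t (fun a => a.2 = B), hy t (fun a => a.2 = B), ← sum_add_distrib]
    beta_reduce
    rw [card_eq_sum_ones]
    apply sum_congr rfl
    intro S hS
    have hS := (mem_filter.1 hS).1
    have h1 := hpath S hS B
    have h2 := hstB S
    have h3 := hQ S hS
    rw [if_neg (by omega)] at h1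
    simp only [and_true]
    split_ifs at h1 ⊢ <;> omega
  · intro t u hu huB
    rw [hf t (fun a => a.2 = u), hy t (fun a => a.2 = u), hf t (fun a => a.1 = u),
      hy t (fun a => a.1 = u), ← sum_add_distrib, ← sum_add_distrib]
    apply sum_congr rfl
    intro S hS
    have hS := (mem_filter.1 hS).1
    have h1 := hpath S hS u
    rw [if_neg (by omega)] at h1
    rw [if_neg (by omega)]
    split_ifs at h1 ⊢ <;> omega
  · intro t c hc hcB
    have e1 : ∑ a ∈ (flowAJ n B s).filter (fun a => a.2 - a.1 = c), f a t
        = (univ.filter (fun j => s j = c ∧ tb j = t)).card := by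
      rw [hf t (fun a => a.2 - a.1 = c),
        card_eq_sum_card_fiberwise (f := Q.part) (t := Q.parts.filter (fun S => tS S = t))]
      · apply sum_congr rfl
        intro S hS
        obtain ⟨h1, h2⟩ := mem_filter.1 hS
        congr 1
        ext j
        simp only [mem_filter, mem_univ, true_and, arc, Nat.add_sub_cancel_left]
        constructor
        · rintro ⟨h3, h4⟩
          have h5 : Q.part j = S := Q.part_eq_of_mem h1 h3
          exact ⟨⟨h4, by simp only [tb, h5, h2]⟩, h5⟩
        · rintro ⟨⟨h, _⟩, rfl⟩; exact ⟨hmem j, h⟩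
      · intro j hj
        have := (mem_filter.1 (mem_coe.1 hj)).2
        exact mem_coe.2 (mem_filter.2 ⟨hpart j, this.2⟩)
    rw [← Nat.cast_sum, e1]
    simp only [card_filter]
    push_cast
    rw [← sum_sub_distrib, ← sum_sub_distrib]
    apply sum_congr rfl
    intro j _
    have h1 : p j = P t ↔ (idx j).val = t.val := by
      rw [hidx j, hPmono.injective.eq_iff, Fin.ext_iff]
    have h2 := hidxtb j
    simp only [h1, Fin.ext_iff]
    split_ifs <;> omega
  · rw [← sum_fiberwise_of_maps_to (s := Q.parts) (t := univ) (g := tS) (by simp)]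
    apply sum_congr rfl
    intro t _
    rw [mul_comm, ← smul_eq_mul, ← sum_const]
    apply sum_congr rfl
    intro S hS
    obtain ⟨h1, h2⟩ := mem_filter.1 hS
    rw [htS S (Q.nonempty_of_mem_parts h1), h2]

/-- Correctness of the formulation (FLOW): the minimum of the objective value
`∑ t, P t * v t` over all feasible solutions `(f, y, v, z)` of (FLOW) is attained and
equals the optimal makespan `Mopt` of the instance of `1|s_j,B|C_max`.  Schedules are
`Finpartition`s of the job set; capacity-feasibility means every batch `S` satisfies
`∑ j ∈ S, s j ≤ B`; the makespan is `∑ S ∈ Q.parts, S.sup p`; `P : Fin δ → ℕ`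
enumerates, strictly increasingly, exactly the distinct values among the `p j`. -/
theorem FLOW_correct (n B : ℕ) (hn : 1 ≤ n) (hB : 1 ≤ B)
    (s p : Fin n → ℕ) (hs : ∀ j, 1 ≤ s j ∧ s j ≤ B) (hp : ∀ j, 1 ≤ p j)
    (δ : ℕ) (P : Fin δ → ℕ) (hPmono : StrictMono P)
    (hPmem : ∀ t, ∃ j, p j = P t) (hPall : ∀ j, ∃ t, p j = P t)
    (Mopt : ℕ)
    (hopt : IsLeast {M : ℕ | ∃ Q : Finpartition (univ : Finset (Fin n)),
        (∀ S ∈ Q.parts, ∑ j ∈ S, s j ≤ B) ∧ ∑ S ∈ Q.parts, S.sup p = M} Mopt) :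
    IsLeast {M : ℕ | ∃ (f y : ℕ × ℕ → Fin δ → ℕ) (v : Fin δ → ℕ) (z : ℕ → ℕ → ℕ),
        FlowFeasible n B s p δ P f y v z ∧ ∑ t, P t * v t = M} Mopt := by
  constructor
  · obtain ⟨Q, hQ, hM⟩ := hopt.1
    obtain ⟨f, y, v, z, h, hv⟩ := sched_to_flow n B hn s p hs δ P hPmono hPall Q hQ
    exact ⟨f, y, v, z, h, hv.trans hM⟩
  · rintro M ⟨f, y, v, z, h, rfl⟩
    obtain ⟨Q, hQ, hM⟩ := flow_to_sched n B s p hs δ P hPmono hPall f y v z h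
    exact (hopt.2 ⟨Q, hQ, rfl⟩).trans hM
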